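/- Let Q have a private attribute B, i.e., B occurs in exactly one relation of Q. Let A be a certificate for Q that is satisfied by at least one database instance. Then the argument obtained from A by deleting every comparison that involves a B-variable is again a certificate. In particular, a minimum-size certificate satisfied by a given instance contains no comparison involving variables on a private attribute. -/

import Mathlib

/-! Core model of indexed natural-join queries, arguments and certificates. -/

/-- `x` is a valid index tuple for a search tree with fanout function `f` and depth
(arity) `ar`: it is nonempty, of length at most `ar`, and every coordinate is `1`-based
and within the fanout of the corresponding prefix. -/
def ValidIdx (f : List ℕ → ℕ) (ar : ℕ) (x : List ℕ) : Prop :=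
  x ≠ [] ∧ x.length ≤ ar ∧
    ∀ j : Fin x.length, 1 ≤ x.get j ∧ x.get j ≤ f (x.take j.val)

/-- `v` is a valid valuation (a "database instance") for the search-tree shape `(f, ar)`:
the values assigned to the children of a common prefix strictly increase. -/
def IsInstVal (f : List ℕ → ℕ) (ar : ℕ) (v : List ℕ → ℕ) : Prop :=
  ∀ (x : List ℕ) (i : ℕ), ValidIdx f ar (x ++ [i]) → ValidIdx f ar (x ++ [i + 1]) →
    v (x ++ [i]) < v (x ++ [i + 1])

/-- A symbolic comparison `R[x] θ S[y]` between two variables, `θ ∈ {<, =, >}`. -/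
structure Comp (ι : Type) where
  R : ι
  x : List ℕ
  S : ι
  y : List ℕ
  o : Ordering
deriving DecidableEq

variable {n : ℕ} {ι : Type}

/-- The list of attributes of relation `R`, in the order of the GAO `ρ`. -/
def attrList (attrs : ι → Finset (Fin n)) (ρ : List (Fin n)) (R : ι) : List (Fin n) :=
  ρ.filter (fun a => decide (a ∈ attrs R))

/-- The arity of relation `R`. -/
def arity (attrs : ι → Finset (Fin n)) (ρ : List (Fin n)) (R : ι) : ℕ :=
  (attrList attrs ρ R).length

/-- Well-formedness of a comparison: both index tuples are valid, and the two variables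
are on the same attribute. -/
def CompWF (attrs : ι → Finset (Fin n)) (ρ : List (Fin n)) (f : ι → List ℕ → ℕ)
    (c : Comp ι) : Prop :=
  ValidIdx (f c.R) (arity attrs ρ c.R) c.x ∧
  ValidIdx (f c.S) (arity attrs ρ c.S) c.y ∧
  (attrList attrs ρ c.R)[c.x.length - 1]? = (attrList attrs ρ c.S)[c.y.length - 1]?

/-- The valuation `v` satisfies the comparison `c`. -/
def SatComp (v : ι → List ℕ → ℕ) (c : Comp ι) : Prop :=
  compare (v c.R c.x) (v c.S c.y) = c.o

/-- `W` is a witness: one full valid index tuple per relation, all contributing to a common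
output tuple `t`. -/
def IsWitness (attrs : ι → Finset (Fin n)) (ρ : List (Fin n)) (f : ι → List ℕ → ℕ)
    (v : ι → List ℕ → ℕ) (W : ι → List ℕ) : Prop :=
  (∀ R, ValidIdx (f R) (arity attrs ρ R) (W R) ∧ (W R).length = arity attrs ρ R) ∧
  ∃ t : Fin n → ℕ, ∀ (R : ι) (j : ℕ) (a : Fin n),
    (attrList attrs ρ R)[j]? = some a → v R ((W R).take (j + 1)) = t a

/-- `A` is a certificate for the shape `f`: all its comparisons are well-formed, and any two
valuations (database instances with this index structure) satisfying all comparisons of `A`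
have exactly the same witnesses. -/
def IsCert (attrs : ι → Finset (Fin n)) (ρ : List (Fin n)) (f : ι → List ℕ → ℕ)
    (A : Finset (Comp ι)) : Prop :=
  (∀ c ∈ A, CompWF attrs ρ f c) ∧
  ∀ v v' : ι → List ℕ → ℕ,
    (∀ R, IsInstVal (f R) (arity attrs ρ R) (v R)) →
    (∀ R, IsInstVal (f R) (arity attrs ρ R) (v' R)) →
    (∀ c ∈ A, SatComp v c) → (∀ c ∈ A, SatComp v' c) →
    ∀ W, IsWitness attrs ρ f v W ↔ IsWitness attrs ρ f v' W

/-! The search tree (trie) derived from raw relational data. -/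

/-- The `k`-th smallest element of a finite set of naturals (`1`-based). -/
def nthVal (s : Finset ℕ) (k : ℕ) : ℕ := (s.sort (· ≤ ·)).getD (k - 1) 0

/-- The list of values along the path of index tuple `x` in the search tree of the data
`D` with attribute list `L`. -/
def dbValList : List ℕ → Finset (Fin n → ℕ) → List (Fin n) → List ℕ
  | [], _, _ => []
  | _ :: _, _, [] => []
  | i :: xs, D, a :: L' =>
    let w := nthVal (D.image (fun t => t a)) i
    w :: dbValList xs (D.filter (fun t => t a = w)) L'

/-- The fanout below index tuple `x` in the search tree of the data `D` with attribute
list `L`. -/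
def dbFanout : List ℕ → Finset (Fin n → ℕ) → List (Fin n) → ℕ
  | _, _, [] => 0
  | [], D, a :: _ => (D.image (fun t => t a)).card
  | i :: xs, D, a :: L' =>
    let w := nthVal (D.image (fun t => t a)) i
    dbFanout xs (D.filter (fun t => t a = w)) L'

/-- The index structure (shape) of the database `DB`, indexed consistently with the GAO
`ρ`. -/
def dbShape (attrs : ι → Finset (Fin n)) (ρ : List (Fin n))
    (DB : ι → Finset (Fin n → ℕ)) : ι → List ℕ → ℕ :=
  fun R x => dbFanout x (DB R) (attrList attrs ρ R)

/-- The value of the variable `R[x]` in the search trees of the database `DB`, indexed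
consistently with the GAO `ρ`. -/
def dbValue (attrs : ι → Finset (Fin n)) (ρ : List (Fin n))
    (DB : ι → Finset (Fin n → ℕ)) : ι → List ℕ → ℕ :=
  fun R x => (dbValList x (DB R) (attrList attrs ρ R)).getD (x.length - 1) 0

/-- The comparison `c` involves a variable on the attribute `B`. -/
def InvolvesAttr (attrs : ι → Finset (Fin n)) (ρ : List (Fin n)) (B : Fin n)
    (c : Comp ι) : Prop :=
  (attrList attrs ρ c.R)[c.x.length - 1]? = some B ∨
  (attrList attrs ρ c.S)[c.y.length - 1]? = some B

instance (attrs : ι → Finset (Fin n)) (ρ : List (Fin n)) (B : Fin n) :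
    DecidablePred (InvolvesAttr attrs ρ B) := fun c => by
  unfold InvolvesAttr; infer_instance

/-- Whether a tuple is a witness depends only on the variables on attributes other than a private
attribute `B`. -/
theorem IsWitness.of_agree_off_private {n : ℕ} {ι : Type}
    {attrs : ι → Finset (Fin n)} {ρ : List (Fin n)} (hnd : ρ.Nodup)
    {f : ι → List ℕ → ℕ} {B : Fin n} (hpriv : ∃! R : ι, B ∈ attrs R)
    {v w : ι → List ℕ → ℕ}
    (h : ∀ R x, (attrList attrs ρ R)[x.length - 1]? ≠ some B → v R x = w R x)
    {W : ι → List ℕ} (hW : IsWitness attrs ρ f v W) : IsWitness attrs ρ f w W := by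
  obtain ⟨hval, t, ht⟩ := hW
  obtain ⟨R₀, -, huniq⟩ := hpriv
  refine ⟨hval, Function.update t B
    (w R₀ ((W R₀).take ((attrList attrs ρ R₀).idxOf B + 1))), fun R j a hj => ?_⟩
  obtain ⟨hlt, hget⟩ := List.getElem?_eq_some_iff.mp hj
  by_cases ha : a = B
  · subst ha
    have hmem : a ∈ attrList attrs ρ R := List.mem_of_getElem? hj
    have hR : R = R₀ := huniq R (by simpa using (List.mem_filter.mp hmem).2)
    subst hR
    have hidx : (attrList attrs ρ R).idxOf a = j := by
      rw [← hget]
      exact (hnd.filter _).idxOf_getElem j hlt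
    rw [Function.update_self, hidx]
  · rw [Function.update_of_ne ha, ← ht R j a hj]
    refine (h R _ ?_).symm
    have hlen : ((W R).take (j + 1)).length - 1 = j := by
      have hWR := (hval R).2
      rw [arity] at hWR
      rw [List.length_take]
      omega
    rw [hlen, hj]
    simpa using ha

/-- Take the values of `v₀` on the `B`-variables and those of `v` elsewhere. -/
def graftAttr {n : ℕ} {ι : Type} (attrs : ι → Finset (Fin n)) (ρ : List (Fin n)) (B : Fin n)
    (v₀ v : ι → List ℕ → ℕ) : ι → List ℕ → ℕ :=
  fun R x => if (attrList attrs ρ R)[x.length - 1]? = some B then v₀ R x else v R x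

theorem isInstVal_graftAttr {n : ℕ} {ι : Type} {attrs : ι → Finset (Fin n)} {ρ : List (Fin n)}
    {f : ι → List ℕ → ℕ} {B : Fin n} {v₀ v : ι → List ℕ → ℕ} {R : ι}
    (h₀ : IsInstVal (f R) (arity attrs ρ R) (v₀ R))
    (h : IsInstVal (f R) (arity attrs ρ R) (v R)) :
    IsInstVal (f R) (arity attrs ρ R) (graftAttr attrs ρ B v₀ v R) := by
  intro x i hi hi'
  simp only [graftAttr, List.length_append, List.length_singleton]
  split_ifs
  · exact h₀ x i hi hi'
  · exact h x i hi hi'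

theorem satComp_graftAttr {n : ℕ} {ι : Type} {attrs : ι → Finset (Fin n)} {ρ : List (Fin n)}
    {f : ι → List ℕ → ℕ} {B : Fin n} {v₀ v : ι → List ℕ → ℕ} {c : Comp ι}
    (hwf : CompWF attrs ρ f c) (h₀ : SatComp v₀ c)
    (h : ¬ InvolvesAttr attrs ρ B c → SatComp v c) :
    SatComp (graftAttr attrs ρ B v₀ v) c := by
  have heq := hwf.2.2
  by_cases hB : (attrList attrs ρ c.S)[c.y.length - 1]? = some B
  · simpa [SatComp, graftAttr, heq, hB] using h₀
  · have hsat : SatComp v c := h (by simp [InvolvesAttr, heq, hB])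
    simpa [SatComp, graftAttr, heq, hB] using hsat

/-- A valuation and its graft have the same witnesses when the grafted attribute is private. -/
theorem isWitness_graftAttr_iff {n : ℕ} {ι : Type} {attrs : ι → Finset (Fin n)}
    {ρ : List (Fin n)} (hnd : ρ.Nodup) {f : ι → List ℕ → ℕ} {B : Fin n}
    (hpriv : ∃! R : ι, B ∈ attrs R) (v₀ v : ι → List ℕ → ℕ) (W : ι → List ℕ) :
    IsWitness attrs ρ f (graftAttr attrs ρ B v₀ v) W ↔ IsWitness attrs ρ f v W :=
  ⟨IsWitness.of_agree_off_private hnd hpriv fun _ _ hx => if_neg hx,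
    IsWitness.of_agree_off_private hnd hpriv fun _ _ hx => (if_neg hx).symm⟩

/-- Deleting the comparisons on a private attribute from a satisfiable certificate leaves a
certificate. -/
theorem IsCert.filter_not_involvesAttr {n : ℕ} {ι : Type}
    {attrs : ι → Finset (Fin n)} {ρ : List (Fin n)} (hnd : ρ.Nodup)
    {f : ι → List ℕ → ℕ} {B : Fin n} (hpriv : ∃! R : ι, B ∈ attrs R)
    {A : Finset (Comp ι)} (hA : IsCert attrs ρ f A) {v₀ : ι → List ℕ → ℕ}
    (hv₀ : ∀ R, IsInstVal (f R) (arity attrs ρ R) (v₀ R)) (hsat : ∀ c ∈ A, SatComp v₀ c) :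
    IsCert attrs ρ f (A.filter (fun c => ¬ InvolvesAttr attrs ρ B c)) := by
  refine ⟨fun c hc => hA.1 c (Finset.mem_filter.mp hc).1, fun v v' hv hv' hs hs' W => ?_⟩
  have graft_sat : ∀ u : ι → List ℕ → ℕ,
      (∀ c ∈ A.filter (fun c => ¬ InvolvesAttr attrs ρ B c), SatComp u c) →
      ∀ c ∈ A, SatComp (graftAttr attrs ρ B v₀ u) c := fun u hu c hc =>
    satComp_graftAttr (hA.1 c hc) (hsat c hc) fun hB => hu c (Finset.mem_filter.mpr ⟨hc, hB⟩)
  rw [← isWitness_graftAttr_iff hnd hpriv v₀ v, ← isWitness_graftAttr_iff hnd hpriv v₀ v']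
  exact hA.2 _ _ (fun R => isInstVal_graftAttr (hv₀ R) (hv R))
    (fun R => isInstVal_graftAttr (hv₀ R) (hv' R)) (graft_sat v hs) (graft_sat v' hs') W

/-- Let `B` be an attribute occurring in exactly one relation of the query (a private
attribute), and let `A` be a certificate satisfied by at least one database instance.  Then
deleting from `A` every comparison involving a `B`-variable again yields a certificate.
In particular, a minimum-size certificate satisfied by a given instance contains no
comparison involving variables on the private attribute. -/
theorem stmt_6 {n : ℕ} {ι : Type} [DecidableEq ι]
    (attrs : ι → Finset (Fin n)) (ρ : List (Fin n)) (hnd : ρ.Nodup) (hall : ∀ a : Fin n, a ∈ ρ)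
    (f : ι → List ℕ → ℕ) (B : Fin n) (hpriv : ∃! R : ι, B ∈ attrs R)
    (A : Finset (Comp ι)) (hA : IsCert attrs ρ f A)
    (hsat : ∃ v : ι → List ℕ → ℕ,
      (∀ R, IsInstVal (f R) (arity attrs ρ R) (v R)) ∧ ∀ c ∈ A, SatComp v c) :
    IsCert attrs ρ f (A.filter (fun c => ¬ InvolvesAttr attrs ρ B c)) ∧
    (∀ (v : ι → List ℕ → ℕ), (∀ R, IsInstVal (f R) (arity attrs ρ R) (v R)) →
      ∀ C : Finset (Comp ι), IsCert attrs ρ f C → (∀ c ∈ C, SatComp v c) →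
      (∀ C' : Finset (Comp ι), IsCert attrs ρ f C' → (∀ c ∈ C', SatComp v c) →
        C.card ≤ C'.card) →
      ∀ c ∈ C, ¬ InvolvesAttr attrs ρ B c) := by
  obtain ⟨v₀, hv₀, hsat₀⟩ := hsat
  refine ⟨hA.filter_not_involvesAttr hnd hpriv hv₀ hsat₀, fun v hv C hC hCsat hmin c hc => ?_⟩
  have hle := hmin _ (hC.filter_not_involvesAttr hnd hpriv hv hCsat)
    fun c hc => hCsat c (Finset.mem_filter.mp hc).1
  exact Finset.filter_eq_self.mp (Finset.eq_of_subset_of_card_le (Finset.filter_subset _ _) hle) c hc
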